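/- Let c_1, …, c_n ∈ C be pairwise distinct with n ≥ 1, let m_1, …, m_n be positive integers, and let L = D + Σ_{i=1}^n m_i/(x - c_i) (the first-order operator annihilating 1/q for q = ∏_{i=1}^n (x - c_i)^{m_i}). Then Sind(L) = Σ_{i=1}^n m_i = deg(q). -/

import Mathlib

open Polynomial

/-- The derivative of a rational function, computed via the quotient rule on the
reduced numerator/denominator representation. -/
noncomputable def rderiv {C : Type} [Field C] (f : RatFunc C) : RatFunc C :=
  algebraMap (Polynomial C) (RatFunc C)
      (derivative f.num * f.denom - f.num * derivative f.denom) /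
    algebraMap (Polynomial C) (RatFunc C) (f.denom ^ 2)

/-- The adjoint of the first-order operator `D + f` applied to `r`: `L*(r) = -r' + f*r`. -/
noncomputable def adjD {C : Type} [Field C] (f r : RatFunc C) : RatFunc C :=
  -rderiv r + f * r

/-- The stability index of an operator with adjoint action `adj` on `C(x)`: the minimal
`m` such that for every `i ≥ m` there is a polynomial of degree `i` in the image of the
adjoint on `C(x)`. -/
noncomputable def sindOf {C : Type} [Field C] (adj : RatFunc C → RatFunc C) : ℕ :=
  sInf {m : ℕ | ∀ i : ℕ, m ≤ i → ∃ p : Polynomial C, p.degree = (i : ℕ) ∧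
    ∃ r : RatFunc C, adj r = algebraMap (Polynomial C) (RatFunc C) p}

lemma natDegree_X_mul_derivative_le {C : Type} [Field C] (p : C[X]) :
    (X * derivative p).natDegree ≤ p.natDegree := by
  refine natDegree_le_iff_coeff_eq_zero.2 fun k hk => ?_
  cases k with
  | zero => simp
  | succ k => rw [coeff_X_mul, coeff_derivative, coeff_eq_zero_of_natDegree_lt hk, zero_mul]

lemma coeff_X_mul_derivative {C : Type} [Field C] (p : C[X]) (k : ℕ) :
    (X * derivative p).coeff k = k * p.coeff k := by
  cases k with
  | zero => simp
  | succ k => rw [coeff_X_mul, coeff_derivative]; push_cast; ring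

lemma rderiv_algebraMap {C : Type} [Field C] (p : C[X]) :
    rderiv (algebraMap C[X] (RatFunc C) p) = algebraMap C[X] (RatFunc C) (derivative p) := by
  simp [rderiv]

lemma sum_div_mul_prod_eq_derivative {C ι : Type} [Field C] (s : Finset ι) (c : ι → C)
    (m : ι → ℕ) :
    (∑ i ∈ s, (m i : RatFunc C) / (RatFunc.X - RatFunc.C (c i))) *
        algebraMap C[X] (RatFunc C) (∏ i ∈ s, (X - Polynomial.C (c i)) ^ m i) =
      algebraMap C[X] (RatFunc C) (derivative (∏ i ∈ s, (X - Polynomial.C (c i)) ^ m i)) := by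
  classical
  induction s using Finset.induction_on with
  | empty => simp
  | insert i s hi ih =>
    have hX : RatFunc.X - RatFunc.C (c i) =
        algebraMap C[X] (RatFunc C) (X - Polynomial.C (c i)) := by simp
    have h0 : algebraMap C[X] (RatFunc C) (X - Polynomial.C (c i)) ≠ 0 :=
      RatFunc.algebraMap_ne_zero (X_sub_C_ne_zero _)
    rw [Finset.sum_insert hi, Finset.prod_insert hi, derivative_mul, derivative_X_sub_C_pow,
      map_add, map_mul, map_mul, map_mul, map_mul, ← ih, hX, map_pow, map_pow, map_natCast,
      map_natCast]
    rcases Nat.eq_zero_or_pos (m i) with h | h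
    · simp [h]
    · obtain ⟨k, hk⟩ := Nat.exists_eq_succ_of_ne_zero h.ne'
      rw [hk, Nat.succ_sub_one, pow_succ]
      field_simp

/-- The leading terms cannot match: `p / q` has a nonzero residue at infinity, hence has no
rational primitive. -/
lemma natDegree_add_one_ne_of_wronskian_eq {C : Type} [Field C] [CharZero C] {N E q p : C[X]}
    (hE : E ≠ 0) (hq : q ≠ 0) (hp : p ≠ 0)
    (h : -(derivative N * E - N * derivative E) * q + derivative q * N * E = p * E ^ 2 * q) :
    p.natDegree + 1 ≠ q.natDegree := by
  intro hd
  set a := N.natDegree with ha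
  set b := E.natDegree with hb
  set d := q.natDegree with hqd
  have hθ : -(X * derivative N * E * q) + N * (X * derivative E) * q + N * E * (X * derivative q)
      = X * p * E ^ 2 * q := by linear_combination X * h
  have hN := natDegree_X_mul_derivative_le N
  have hE' := natDegree_X_mul_derivative_le E
  have hq' := natDegree_X_mul_derivative_le q
  have hR : X * p * E ^ 2 * q ≠ 0 := by simp [hE, hq, hp]
  have hRd : (X * p * E ^ 2 * q).natDegree = 2 * d + 2 * b := by
    rw [natDegree_mul (by simp [hE, hp]) hq, natDegree_mul (by simp [hp]) (by simp [hE]),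
      natDegree_X_mul hp, natDegree_pow]
    omega
  have hLd : (X * p * E ^ 2 * q).natDegree ≤ a + b + d := by
    rw [← hθ]
    refine natDegree_add_le_of_degree_le (natDegree_add_le_of_degree_le ?_ ?_) ?_
    · rw [natDegree_neg]
      exact natDegree_mul_le_of_le (natDegree_mul_le_of_le hN le_rfl) le_rfl
    · exact natDegree_mul_le_of_le (natDegree_mul_le_of_le le_rfl hE') le_rfl
    · exact natDegree_mul_le_of_le (natDegree_mul_le_of_le le_rfl le_rfl) hq'
  have hc : (X * p * E ^ 2 * q).coeff (a + b + d) =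
      ((b + d : ℕ) - (a : ℕ) : C) * (N.leadingCoeff * E.leadingCoeff * q.leadingCoeff) := by
    rw [← hθ, coeff_add, coeff_add, coeff_neg,
      coeff_mul_add_eq_of_natDegree_le (natDegree_mul_le_of_le hN le_rfl) le_rfl,
      coeff_mul_add_eq_of_natDegree_le hN le_rfl,
      coeff_mul_add_eq_of_natDegree_le (natDegree_mul_le_of_le le_rfl hE') le_rfl,
      coeff_mul_add_eq_of_natDegree_le le_rfl hE',
      coeff_mul_add_eq_of_natDegree_le (natDegree_mul_le_of_le le_rfl le_rfl) hq',
      coeff_mul_add_eq_of_natDegree_le le_rfl le_rfl]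
    simp only [coeff_X_mul_derivative, leadingCoeff, ← ha, ← hb, ← hqd]
    push_cast
    ring
  rcases eq_or_ne a (b + d) with hab | hab
  · rw [← hab, sub_self, zero_mul, show a + b + d = (X * p * E ^ 2 * q).natDegree by omega] at hc
    exact hR (leadingCoeff_eq_zero.1 hc)
  · rw [coeff_eq_zero_of_natDegree_lt (by omega)] at hc
    have hN0 : N ≠ 0 := by
      rintro rfl
      simp only [natDegree_zero] at ha
      omega
    have hne : ((b + d : ℕ) - (a : ℕ) : C) ≠ 0 := by
      rw [sub_ne_zero]
      exact_mod_cast hab.symm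
    exact mul_ne_zero hne (by simp [hN0, hE, hq]) hc.symm

/-- For `f` the logarithmic derivative of `q`, the adjoint of `D + f` reaches no polynomial of degree `deg q - 1`. -/
lemma natDegree_add_one_ne_of_adjD_eq {C : Type} [Field C] [CharZero C] {f r : RatFunc C} {q p : C[X]}
    (hq : q ≠ 0) (hp : p ≠ 0)
    (hf : f * algebraMap C[X] (RatFunc C) q = algebraMap C[X] (RatFunc C) (derivative q))
    (h : adjD f r = algebraMap C[X] (RatFunc C) p) : p.natDegree + 1 ≠ q.natDegree := by
  refine natDegree_add_one_ne_of_wronskian_eq (N := r.num) (E := r.denom) r.denom_ne_zero hq hp ?_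
  apply RatFunc.algebraMap_injective C
  have hE : algebraMap C[X] (RatFunc C) r.denom ≠ 0 :=
    RatFunc.algebraMap_ne_zero r.denom_ne_zero
  have hr : r * algebraMap C[X] (RatFunc C) r.denom = algebraMap C[X] (RatFunc C) r.num :=
    ((eq_div_iff hE).1 (RatFunc.num_div_denom r).symm)
  have hd : rderiv r * algebraMap C[X] (RatFunc C) r.denom ^ 2 = algebraMap C[X] (RatFunc C)
      (derivative r.num * r.denom - r.num * derivative r.denom) := by
    rw [rderiv, map_pow, div_mul_cancel₀ _ (pow_ne_zero 2 hE)]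
  rw [adjD] at h
  rw [map_add, map_mul, map_neg, ← hd, map_mul, map_mul, ← hf, ← hr, map_mul, map_mul, map_pow,
    ← h]
  ring

/-- For `f` the logarithmic derivative of `q`, the adjoint of `D + f` reaches a polynomial of every degree `≥ deg q`. -/
lemma exists_adjD_eq {C : Type} [Field C] [CharZero C] {f : RatFunc C} {q : C[X]}
    (hq : q ≠ 0)
    (hf : f * algebraMap C[X] (RatFunc C) q = algebraMap C[X] (RatFunc C) (derivative q))
    {i : ℕ} (hi : q.natDegree ≤ i) :
    ∃ p : C[X], p.degree = i ∧ ∃ r, adjD f r = algebraMap C[X] (RatFunc C) p := by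
  obtain ⟨j, rfl⟩ := Nat.exists_eq_add_of_le hi
  have hj : (-((j : C) + 1)) ≠ 0 := neg_ne_zero.2 (Nat.cast_add_one_ne_zero j)
  refine ⟨q * (Polynomial.C (-((j : C) + 1)) * X ^ j), ?_,
    algebraMap C[X] (RatFunc C) (q * X ^ (j + 1)), ?_⟩
  · rw [degree_mul, degree_C_mul_X_pow j hj, degree_eq_natDegree hq]
    rfl
  · rw [adjD, rderiv_algebraMap, map_mul (algebraMap C[X] (RatFunc C)) q, ← mul_assoc, hf, ← map_mul, ← map_neg, ← map_add]
    congr 1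
    rw [derivative_mul, derivative_X_pow]
    simp only [map_neg, map_add, map_natCast, map_one, Nat.cast_add, Nat.cast_one,
      Nat.add_sub_cancel]
    ring

/-- Corollary 6.4. For `L = D + Σ_{i=1}^n m_i/(x - c_i)` with the
`c_i` pairwise distinct and the `m_i` positive integers, `Sind(L) = Σ_i m_i = deg q`
where `q = ∏_i (x - c_i)^{m_i}`. -/
theorem sind_log_derivative_operator {C : Type} [Field C] [IsAlgClosed C] [CharZero C]
    (n : ℕ) (hn : 1 ≤ n) (c : Fin n → C) (hc : Function.Injective c)
    (m : Fin n → ℕ) (hm : ∀ i, 0 < m i) :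
    sindOf (adjD (∑ i, (m i : RatFunc C) / (RatFunc.X - RatFunc.C (c i)))) = ∑ i, m i ∧
    (∑ i, m i) = (∏ i, (X - Polynomial.C (c i)) ^ m i).natDegree := by
  have hdeg : (∑ i, m i) = (∏ i, (X - Polynomial.C (c i)) ^ m i).natDegree := by
    rw [natDegree_prod_of_monic _ _ fun i _ => (monic_X_sub_C (c i)).pow (m i)]
    simp
  refine ⟨?_, hdeg⟩
  have hf := sum_div_mul_prod_eq_derivative Finset.univ c m
  have hq : (∏ i, (X - Polynomial.C (c i)) ^ m i) ≠ 0 :=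
    (monic_prod_of_monic _ _ fun i _ => (monic_X_sub_C (c i)).pow (m i)).ne_zero
  have hpos : 0 < ∑ i, m i :=
    Finset.sum_pos (fun i _ => hm i) ⟨⟨0, hn⟩, Finset.mem_univ _⟩
  rw [hdeg] at hpos ⊢
  refine IsLeast.csInf_eq ⟨fun i hi => exists_adjD_eq hq hf hi, fun k hk => ?_⟩
  by_contra! hlt
  obtain ⟨p, hp, r, hr⟩ := hk _ (Nat.le_sub_one_of_lt hlt)
  have hp0 : p ≠ 0 := by
    rintro rfl
    simp at hp
  refine natDegree_add_one_ne_of_adjD_eq hq hp0 hf hr ?_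
  rw [natDegree_eq_of_degree_eq_some hp]
  omega
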